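/- The equivalent death-state environment is a proper measure: Let μ be an environment semimeasure over percept set E and μ' its equivalent death-state environment over E_d = E ∪ {e^d}. Then for every history h over A × E_d with μ'(h) > 0 and every action a ∈ A, Σ_{e∈E_d} μ'(e | h, a) = 1; in particular μ' is an environment semimeasure over E_d with L_{μ'}(h, a) = 0 everywhere. -/

import Mathlib

open scoped BigOperators

/-- A history is a finite list of action–percept pairs. -/
abbrev Hist (A E : Type) := List (A × E)

/-- An environment semimeasure: values in [0,1], mass 1 on the empty history,
and the mass of one-step extensions does not exceed the mass of the history. -/
def IsEnvSemimeasure {A E : Type} [Fintype E] (ν : Hist A E → ℝ) : Prop :=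
  (∀ h : Hist A E, 0 ≤ ν h ∧ ν h ≤ 1) ∧ ν ([] : Hist A E) = 1 ∧
    ∀ (h : Hist A E) (a : A), (∑ e : E, ν (h ++ [(a, e)])) ≤ ν h

/-- Conditional probability ν(e | h, a). -/
noncomputable def condProb {A E : Type} (ν : Hist A E → ℝ) (h : Hist A E) (a : A) (e : E) : ℝ :=
  ν (h ++ [(a, e)]) / ν h

/-- Instantaneous measure loss L_ν(h, a). -/
noncomputable def measLoss {A E : Type} [Fintype E] (ν : Hist A E → ℝ) (h : Hist A E) (a : A) : ℝ :=
  1 - ∑ e : E, condProb ν h a e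
/-- Strip the death-percept structure: a history over `A × Option E` with no `none`
corresponds to the history over `A × E` obtained by removing the `some`s. -/
def strip {A E : Type} (h : Hist A (Option E)) : Hist A E :=
  h.filterMap (fun p => p.2.map (fun e => (p.1, e)))

/-- Embed an ordinary history over `A × E` into histories over `A × Option E`
(where `none` plays the role of the death-percept `e^d`). -/
def embed {A E : Type} (h : Hist A E) : Hist A (Option E) :=
  h.map (fun p => (p.1, some p.2))

/-- Conditional probabilities of the equivalent death-state environment μ':
if the history contains the death-percept `none`, the death-percept recurs with
probability 1; otherwise percepts in E keep their μ-probability and the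
death-percept gets the μ-measure loss. -/
noncomputable def deathCond {A E : Type} [Fintype E] [DecidableEq A] [DecidableEq E]
    (μ : Hist A E → ℝ) (h : Hist A (Option E)) (a : A) : Option E → ℝ
  | Option.none =>
      if (Option.none : Option E) ∈ h.map Prod.snd then 1 else measLoss μ (strip h) a
  | Option.some e =>
      if (Option.none : Option E) ∈ h.map Prod.snd then 0 else condProb μ (strip h) a e

noncomputable def deathEnvAux {A E : Type} [Fintype E] [DecidableEq A] [DecidableEq E]
    (μ : Hist A E → ℝ) : List (A × Option E) → ℝ
  | [] => 1
  | (a, e) :: rest => deathEnvAux μ rest * deathCond μ rest.reverse a e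

/-- The equivalent death-state environment μ': μ'([]) = 1 and
μ'(h ++ [(a,e)]) = μ'(h) · μ'(e | h, a) with conditionals `deathCond`. -/
noncomputable def deathEnv {A E : Type} [Fintype E] [DecidableEq A] [DecidableEq E]
    (μ : Hist A E → ℝ) (h : Hist A (Option E)) : ℝ :=
  deathEnvAux μ h.reverse

theorem deathCond_sum_aux {A E : Type} [Fintype E] [DecidableEq A] [DecidableEq E]
    (μ : Hist A E → ℝ) (h : Hist A (Option E)) (a : A) :
    ∑ e : Option E, deathCond μ h a e = 1 := by
  rw [Fintype.sum_option]
  by_cases hn : (Option.none : Option E) ∈ h.map Prod.snd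
  · simp only [deathCond, if_pos hn]
    simp
  · simp only [deathCond, if_neg hn, measLoss]
    ring

theorem deathCond_nonneg_aux {A E : Type} [Fintype E] [DecidableEq A] [DecidableEq E]
    (μ : Hist A E → ℝ) (hμ : IsEnvSemimeasure μ) (h : Hist A (Option E)) (a : A)
    (e : Option E) : 0 ≤ deathCond μ h a e := by
  obtain ⟨h1, -, h3⟩ := hμ
  by_cases hn : (Option.none : Option E) ∈ h.map Prod.snd
  · cases e <;> simp only [deathCond, if_pos hn] <;> norm_num
  · cases e with
    | none =>
      simp only [deathCond, if_neg hn, measLoss, condProb]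
      rw [← Finset.sum_div, sub_nonneg]
      exact div_le_one_of_le₀ (h3 _ _) (h1 _).1
    | some e =>
      simp only [deathCond, if_neg hn, condProb]
      exact div_nonneg (h1 _).1 (h1 _).1

theorem deathEnv_append_aux {A E : Type} [Fintype E] [DecidableEq A] [DecidableEq E]
    (μ : Hist A E → ℝ) (h : Hist A (Option E)) (a : A) (e : Option E) :
    deathEnv μ (h ++ [(a, e)]) = deathEnv μ h * deathCond μ h a e := by
  simp [deathEnv, deathEnvAux]

theorem deathEnvAux_bounds {A E : Type} [Fintype E] [DecidableEq A] [DecidableEq E]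
    (μ : Hist A E → ℝ) (hμ : IsEnvSemimeasure μ) (l : List (A × Option E)) :
    0 ≤ deathEnvAux μ l ∧ deathEnvAux μ l ≤ 1 := by
  induction l with
  | nil => simp [deathEnvAux]
  | cons p rest ih =>
    obtain ⟨a, e⟩ := p
    have h0 := deathCond_nonneg_aux μ hμ rest.reverse a
    have h1 : deathCond μ rest.reverse a e ≤ 1 := by
      rw [← deathCond_sum_aux μ rest.reverse a]
      exact Finset.single_le_sum (fun i _ => h0 i) (Finset.mem_univ e)
    simp only [deathEnvAux]
    exact ⟨mul_nonneg ih.1 (h0 e), mul_le_one₀ ih.2 (h0 e) h1⟩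

theorem deathEnv_sum_aux {A E : Type} [Fintype E] [DecidableEq A] [DecidableEq E]
    (μ : Hist A E → ℝ) (h : Hist A (Option E)) (a : A) :
    ∑ e : Option E, deathEnv μ (h ++ [(a, e)]) = deathEnv μ h := by
  simp only [deathEnv_append_aux]
  rw [← Finset.mul_sum, deathCond_sum_aux, mul_one]

/-- The equivalent death-state environment is a proper measure:
μ' is an environment semimeasure over E_d = E ∪ {e^d}, and wherever μ'(h) > 0
the conditional probabilities over E_d sum to 1, i.e. L_{μ'}(h, a) = 0. -/
theorem deathEnv_is_proper_measure
    {A E : Type} [Fintype A] [Nonempty A] [Fintype E] [Nonempty E]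
    [DecidableEq A] [DecidableEq E]
    (μ : Hist A E → ℝ) (hμ : IsEnvSemimeasure μ) :
    IsEnvSemimeasure (deathEnv μ) ∧
    ∀ (h : Hist A (Option E)) (a : A), 0 < deathEnv μ h →
      (∑ e : Option E, condProb (deathEnv μ) h a e) = 1 ∧
      measLoss (deathEnv μ) h a = 0 := by
  refine ⟨⟨fun h => deathEnvAux_bounds μ hμ h.reverse, by simp [deathEnv, deathEnvAux],
    fun h a => (deathEnv_sum_aux μ h a).le⟩, fun h a hpos => ?_⟩
  have key : (∑ e : Option E, condProb (deathEnv μ) h a e) = 1 := by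
    simp only [condProb]
    rw [← Finset.sum_div, deathEnv_sum_aux, div_self hpos.ne']
  exact ⟨key, by rw [measLoss, key, sub_self]⟩
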